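/- Let p be a prime, R a commutative ring, and A, B two R-modules. For every R-linear map f : A → B, the map f^{⊗p} sends ker(id - σ_A) into ker(id - σ_B) and sends im(N_A) into im(N_B), hence induces an R-linear map T(f) : T(A) → T(B) on Tate constructions. Moreover, for any two R-linear maps f, g : A → B, one has T(f+g) = T(f) + T(g). -/

import Mathlib

open scoped TensorProduct

noncomputable section

/-- The cyclic shift `σ_M` on `M^{⊗p}`, induced by the cyclic permutation `i ↦ i + 1`
of `Fin p`, so that `σ_M (m_0 ⊗ ⋯ ⊗ m_{p-1}) = m_{p-1} ⊗ m_0 ⊗ ⋯ ⊗ m_{p-2}`. -/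
def cyclicShift (R : Type*) [CommRing R] (p : ℕ) (M : Type*) [AddCommGroup M]
    [Module R M] : Module.End R (⨂[R] _ : Fin p, M) :=
  (PiTensorProduct.reindex R (fun _ : Fin p => M) (finRotate p)).toLinearMap

/-- The norm operator `N_M := Σ_{j=0}^{p-1} σ_M^j` on `M^{⊗p}`. -/
def normOp (R : Type*) [CommRing R] (p : ℕ) (M : Type*) [AddCommGroup M] [Module R M] :
    Module.End R (⨂[R] _ : Fin p, M) :=
  ∑ j ∈ Finset.range p, (cyclicShift R p M) ^ j

/-- The `p`-th tensor power `f^{⊗p}` of a linear map, applying `f` in every factor. -/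
def tensorPow (R : Type*) [CommRing R] (p : ℕ) {M N : Type*} [AddCommGroup M]
    [Module R M] [AddCommGroup N] [Module R N] (f : M →ₗ[R] N) :
    (⨂[R] _ : Fin p, M) →ₗ[R] (⨂[R] _ : Fin p, N) :=
  PiTensorProduct.map (fun _ : Fin p => f)

/-- The kernel of `id - σ_M` inside `M^{⊗p}`. -/
def kerShift (R : Type*) [CommRing R] (p : ℕ) (M : Type*) [AddCommGroup M]
    [Module R M] : Submodule R (⨂[R] _ : Fin p, M) :=
  LinearMap.ker (LinearMap.id - cyclicShift R p M)

/-- The image of the norm `N_M`, viewed as a submodule of `ker (id - σ_M)`. -/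
def normImage (R : Type*) [CommRing R] (p : ℕ) (M : Type*) [AddCommGroup M]
    [Module R M] : Submodule R (kerShift R p M) :=
  Submodule.comap (kerShift R p M).subtype (LinearMap.range (normOp R p M))

/-- The Tate construction `T(M) := ker (id - σ_M) / im (N_M)`. -/
abbrev Tate (R : Type*) [CommRing R] (p : ℕ) (M : Type*) [AddCommGroup M]
    [Module R M] : Type _ :=
  kerShift R p M ⧸ normImage R p M

section FreeCyclicAction

variable {R V ι : Type*} [CommRing R] [AddCommGroup V] [Module R V]

/-- A sum over a finite set carrying a permutation `e` is a norm for `σ`, provided the summand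
intertwines `e` with `σ` and there is an equivariant map `φ` to the torsor `ZMod p`. -/
theorem sum_mem_range_sum_pow {p : ℕ} [NeZero p] (σ : Module.End R V) (e : Equiv.Perm ι)
    (s : Finset ι) (hs : ∀ x, e x ∈ s ↔ x ∈ s) (t : ι → V) (ht : ∀ x, t (e x) = σ (t x))
    (φ : ι → ZMod p) (hφ : ∀ x ∈ s, φ (e x) = φ x + 1) :
    ∑ x ∈ s, t x ∈ LinearMap.range (∑ j ∈ Finset.range p, σ ^ j) := by
  have fiber_sum (j : ℕ) :
      ∑ x ∈ s with φ x = j, t x = (σ ^ j) (∑ x ∈ s with φ x = 0, t x) := by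
    induction j with
    | zero => simp
    | succ j ih =>
      rw [pow_succ', Module.End.mul_apply, ← ih, map_sum]
      refine (Finset.sum_equiv e (fun x => ?_) fun x _ => (ht x).symm).symm
      simp only [Finset.mem_filter, hs]
      refine and_congr_right fun hx => ?_
      rw [hφ x hx, Nat.cast_succ, add_left_inj]
  refine ⟨∑ x ∈ s with φ x = 0, t x, ?_⟩
  rw [LinearMap.sum_apply, ← Finset.sum_fiberwise_of_maps_to (f := t) (s := s) (t := Finset.range p)
    (g := fun x => (φ x).val) fun x _ => Finset.mem_range.2 (ZMod.val_lt _)]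
  refine Finset.sum_congr rfl fun j hj => ?_
  rw [← fiber_sum]
  congr 1
  refine Finset.filter_congr fun x _ => ⟨fun h => ?_, fun h => ?_⟩
  · rw [h, ZMod.val_cast_of_lt (Finset.mem_range.1 hj)]
  · rw [← h, ZMod.natCast_rightInverse]

end FreeCyclicAction

section Tate

variable {R : Type*} [CommRing R] {p : ℕ} {A B : Type*} [AddCommGroup A] [Module R A]
  [AddCommGroup B] [Module R B]

theorem mem_kerShift_iff {v : ⨂[R] _ : Fin p, A} :
    v ∈ kerShift R p A ↔ cyclicShift R p A v = v := by
  rw [kerShift, LinearMap.mem_ker, LinearMap.sub_apply, sub_eq_zero, LinearMap.id_apply, eq_comm]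

theorem cyclicShift_map (F : Fin p → A →ₗ[R] B) (v : ⨂[R] _ : Fin p, A) :
    cyclicShift R p B (PiTensorProduct.map F v) =
      PiTensorProduct.map (fun i => F ((finRotate p).symm i)) (cyclicShift R p A v) :=
  (PiTensorProduct.map_reindex F (finRotate p) v).symm

theorem commute_cyclicShift_tensorPow (f : A →ₗ[R] B) :
    cyclicShift R p B ∘ₗ tensorPow R p f = tensorPow R p f ∘ₗ cyclicShift R p A :=
  LinearMap.ext fun v => cyclicShift_map (fun _ => f) v

theorem tensorPow_mem_kerShift (f : A →ₗ[R] B) {v : ⨂[R] _ : Fin p, A}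
    (hv : v ∈ kerShift R p A) : tensorPow R p f v ∈ kerShift R p B := by
  rw [mem_kerShift_iff] at hv ⊢
  rw [← LinearMap.comp_apply, commute_cyclicShift_tensorPow, LinearMap.comp_apply, hv]

theorem tensorPow_cyclicShift_pow (f : A →ₗ[R] B) (j : ℕ) (v : ⨂[R] _ : Fin p, A) :
    tensorPow R p f ((cyclicShift R p A ^ j) v) =
      (cyclicShift R p B ^ j) (tensorPow R p f v) := by
  induction j with
  | zero => rfl
  | succ j ih =>
    rw [pow_succ', pow_succ', Module.End.mul_apply, Module.End.mul_apply, ← ih]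
    exact (LinearMap.congr_fun (commute_cyclicShift_tensorPow f) _).symm

theorem tensorPow_normOp (f : A →ₗ[R] B) (v : ⨂[R] _ : Fin p, A) :
    tensorPow R p f (normOp R p A v) = normOp R p B (tensorPow R p f v) := by
  simp only [normOp, LinearMap.sum_apply, map_sum, tensorPow_cyclicShift_pow]

theorem tensorPow_mem_range_normOp (f : A →ₗ[R] B) {v : ⨂[R] _ : Fin p, A}
    (hv : v ∈ LinearMap.range (normOp R p A)) :
    tensorPow R p f v ∈ LinearMap.range (normOp R p B) := by
  obtain ⟨u, rfl⟩ := hv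
  exact ⟨tensorPow R p f u, (tensorPow_normOp f u).symm⟩

/-- The map induced by `f` on Tate constructions. -/
def tateMap (f : A →ₗ[R] B) : Tate R p A →ₗ[R] Tate R p B :=
  Submodule.mapQ (normImage R p A) (normImage R p B)
    ((tensorPow R p f).restrict fun _ hv => tensorPow_mem_kerShift f hv)
    fun _ hv => tensorPow_mem_range_normOp f hv

theorem tateMap_mk (f : A →ₗ[R] B) (v : kerShift R p A) (w : kerShift R p B)
    (h : (w : ⨂[R] _ : Fin p, B) = tensorPow R p f v) :
    tateMap f (Submodule.Quotient.mk v) = Submodule.Quotient.mk w :=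
  congrArg Submodule.Quotient.mk (Subtype.ext h.symm)

theorem tensorPow_add (f g : A →ₗ[R] B) :
    tensorPow R p (f + g) =
      ∑ s : Finset (Fin p), PiTensorProduct.map (s.piecewise (fun _ => f) fun _ => g) :=
  (PiTensorProduct.mapMultilinear R (fun _ : Fin p => A) fun _ => B).map_add_univ
    (fun _ => f) fun _ => g

theorem natCast_finRotate [NeZero p] (i : Fin p) :
    ((finRotate p i : ℕ) : ZMod p) = (i : ℕ) + 1 := by
  rw [finRotate_apply, Fin.val_add, ZMod.natCast_mod, Nat.cast_add, Fin.val_one',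
    ZMod.natCast_mod, Nat.cast_one]

theorem tensorPow_add_sub_mem_range_normOp (hp : p.Prime) (f g : A →ₗ[R] B)
    {v : ⨂[R] _ : Fin p, A} (hv : v ∈ kerShift R p A) :
    tensorPow R p (f + g) v - (tensorPow R p f v + tensorPow R p g v) ∈
      LinearMap.range (normOp R p B) := by
  have : Fact p.Prime := ⟨hp⟩
  rw [mem_kerShift_iff] at hv
  let t (s : Finset (Fin p)) : ⨂[R] _ : Fin p, B :=
    PiTensorProduct.map (s.piecewise (fun _ => f) fun _ => g) v
  let S : Finset (Finset (Fin p)) := (Finset.univ.erase Finset.univ).erase ∅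
  have hS : tensorPow R p (f + g) v - (tensorPow R p f v + tensorPow R p g v) =
      ∑ s ∈ S, t s := by
    have hf : t Finset.univ = tensorPow R p f v := by simp [t, tensorPow]
    have hg : t ∅ = tensorPow R p g v := by simp [t, tensorPow]
    have hne : (∅ : Finset (Fin p)) ∈ Finset.univ.erase Finset.univ := by
      simp [Finset.univ_nonempty.ne_empty.symm]
    rw [tensorPow_add, LinearMap.sum_apply, ← hf, ← hg, sub_eq_iff_eq_add',
      ← Finset.add_sum_erase _ _ (Finset.mem_univ Finset.univ),
      ← Finset.add_sum_erase _ _ hne, ← add_assoc]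
  rw [hS]
  have hcard (s : Finset (Fin p)) (hs : s ∈ S) : (s.card : ZMod p) ≠ 0 := by
    simp only [S, Finset.mem_erase, Finset.mem_univ, and_true] at hs
    rw [Ne, ZMod.natCast_eq_zero_iff]
    refine Nat.not_dvd_of_pos_of_lt (Finset.card_pos.2 (Finset.nonempty_iff_ne_empty.2 hs.1)) ?_
    simpa using (Finset.card_lt_iff_ne_univ s).2 hs.2
  refine sum_mem_range_sum_pow (cyclicShift R p B) (finRotate p).finsetCongr S (fun s => ?_) t
    (fun s => ?_) (fun s => (∑ i ∈ s, ((i : ℕ) : ZMod p)) / s.card) fun s hs => ?_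
  · simp [S, ← Finset.card_eq_iff_eq_univ]
  · simp only [t]
    rw [cyclicShift_map, hv]
    congr 2
    ext1 i
    simp [Finset.piecewise, Equiv.finsetCongr_apply, Finset.mem_map_equiv]
  · have := hcard s hs
    simp only [Equiv.finsetCongr_apply, Finset.sum_map, Finset.card_map, Equiv.coe_toEmbedding,
      natCast_finRotate, Finset.sum_add_distrib, Finset.sum_const, nsmul_eq_mul, mul_one]
    rw [add_div, div_self this]

theorem tateMap_add (hp : p.Prime) (f g : A →ₗ[R] B) :
    (tateMap (f + g) : Tate R p A →ₗ[R] Tate R p B) = tateMap f + tateMap g := by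
  refine LinearMap.ext fun x => ?_
  obtain ⟨v, rfl⟩ := Submodule.Quotient.mk_surjective _ x
  exact (Submodule.Quotient.eq _).2 (tensorPow_add_sub_mem_range_normOp hp f g v.2)

end Tate

/-- For any linear map `f : A → B`, the tensor power `f^{⊗p}` sends `ker (id - σ_A)`
into `ker (id - σ_B)` and `im N_A` into `im N_B`, hence induces a map
`T(f) : T(A) → T(B)` on Tate constructions; moreover `T(f + g) = T(f) + T(g)`. -/
theorem tate_map_additive (p : ℕ) (hp : p.Prime) (R : Type*) [CommRing R]
    (A B : Type*) [AddCommGroup A] [Module R A] [AddCommGroup B] [Module R B]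
    (f g : A →ₗ[R] B) :
    (∀ h : A →ₗ[R] B, ∀ v ∈ kerShift R p A, tensorPow R p h v ∈ kerShift R p B) ∧
    (∀ h : A →ₗ[R] B, ∀ v ∈ LinearMap.range (normOp R p A),
      tensorPow R p h v ∈ LinearMap.range (normOp R p B)) ∧
    ∃ Tf Tg Tfg : Tate R p A →ₗ[R] Tate R p B,
      (∀ (v : kerShift R p A) (w : kerShift R p B),
        (w : ⨂[R] _ : Fin p, B) = tensorPow R p f v →
          Tf (Submodule.Quotient.mk v) = Submodule.Quotient.mk w) ∧
      (∀ (v : kerShift R p A) (w : kerShift R p B),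
        (w : ⨂[R] _ : Fin p, B) = tensorPow R p g v →
          Tg (Submodule.Quotient.mk v) = Submodule.Quotient.mk w) ∧
      (∀ (v : kerShift R p A) (w : kerShift R p B),
        (w : ⨂[R] _ : Fin p, B) = tensorPow R p (f + g) v →
          Tfg (Submodule.Quotient.mk v) = Submodule.Quotient.mk w) ∧
      Tfg = Tf + Tg := by
  exact ⟨fun h _ hv => tensorPow_mem_kerShift h hv, fun h _ hv => tensorPow_mem_range_normOp h hv,
    tateMap f, tateMap g, tateMap (f + g), tateMap_mk f, tateMap_mk g, tateMap_mk (f + g),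
    tateMap_add hp f g⟩

end
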